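/- Let Γ^t be a smooth family of graphical tori with smooth defining function F : S¹ × ℂ → ℝ, extended to a smooth function F : Δ̄ × ℂ → ℝ with F(λ,w) = |w|² for all λ ∈ Δ̄ and |w| ≤ ε, and with ∂F/∂w ≠ 0 for w ≠ 0. Then there exists a smooth function φ : Δ̄ × ℂ → ℝ_{≥0} such that Δ_w φ > 0 (the Laplacian of w ↦ φ(λ,w) is positive for each fixed λ), the restriction of φ to S¹ × ℂ defines the foliation by the tori Γ^t (its level sets over S¹ are the Γ^t), and for each |λ| = 1 one has φ_λ^{-1}(1) = C_λ := C¹_λ. -/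

import Mathlib

open Set Metric Complex

noncomputable section

/-- Multiplication by `i` on `ℂ²`. -/
def iSmul (v : ℂ × ℂ) : ℂ × ℂ := (Complex.I * v.1, Complex.I * v.2)

/-- The Euclidean (real) inner product on `ℂ² ≅ ℝ⁴`. -/
def rInner (u v : ℂ × ℂ) : ℝ :=
  (u.1 * (starRingEnd ℂ) v.1 + u.2 * (starRingEnd ℂ) v.2).re

/-- The Euclidean norm on `ℂ² ≅ ℝ⁴`. -/
def rNorm (u : ℂ × ℂ) : ℝ := Real.sqrt (rInner u u)

/-- The Laplacian of a function `f : ℂ → ℝ` at `w`. -/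
def lap (f : ℂ → ℝ) (w : ℂ) : ℝ :=
  iteratedFDeriv ℝ 2 f w ![1, 1] + iteratedFDeriv ℝ 2 f w ![Complex.I, Complex.I]

/-- Restriction of `u : ℂ² → ℝ` to the complex line through `z` in direction `v`. -/
def lineRestr (u : ℂ × ℂ → ℝ) (z v : ℂ × ℂ) : ℂ → ℝ :=
  fun t => u (z + (t * v.1, t * v.2))

/-- `u` is smooth and strictly plurisubharmonic on `U`: its restriction to every complex
line is strictly subharmonic (positive Laplacian). -/
def StrictPSHOn (u : ℂ × ℂ → ℝ) (U : Set (ℂ × ℂ)) : Prop :=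
  ContDiffOn ℝ (⊤ : ℕ∞) u U ∧
    ∀ z ∈ U, ∀ v : ℂ × ℂ, v ≠ 0 → 0 < lap (lineRestr u z v) 0

/-- `Ω` is a bounded strictly pseudoconvex domain with defining function `ρ`: `ρ` is
smooth and strictly plurisubharmonic on a neighborhood `U` of `closure Ω` and
`Ω = {z ∈ U | ρ z < 0}`. -/
def IsStrictPseudoconvexWith (Ω : Set (ℂ × ℂ)) (ρ : ℂ × ℂ → ℝ) : Prop :=
  IsOpen Ω ∧ Ω.Nonempty ∧ Bornology.IsBounded Ω ∧
    ∃ U : Set (ℂ × ℂ), IsOpen U ∧ closure Ω ⊆ U ∧ StrictPSHOn ρ U ∧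
      Ω = {z ∈ U | ρ z < 0}

/-- The closed curve `c` (periodic of period `2π`) has winding number `1` around `0`:
there is a continuous lift of the argument increasing by `2π` over one period. -/
def WindingOne (c : ℝ → ℂ) : Prop :=
  ∃ θ : ℝ → ℝ, Continuous θ ∧
    (∀ t, c t = (‖c t‖ : ℂ) * Complex.exp ((θ t : ℂ) * Complex.I)) ∧
    θ (2 * Real.pi) = θ 0 + 2 * Real.pi

/-- `c : ℝ → ℂ` is a smooth simple closed curve (parametrized with period `2π`). -/
def IsSCC (c : ℝ → ℂ) : Prop :=
  ContDiff ℝ (⊤ : ℕ∞) c ∧ (∀ t, c (t + 2 * Real.pi) = c t) ∧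
    Set.InjOn c (Ico 0 (2 * Real.pi)) ∧ ∀ t, deriv c t ≠ 0

/-- `Γ ⊆ S¹ × ℂ` is a graphical torus: every vertical slice `C_λ` is a smooth simple
closed curve in `ℂ ∖ {0}` with winding number `1` around `0`. -/
def IsGraphicalTorus (Γ : Set (ℂ × ℂ)) : Prop :=
  (∀ p ∈ Γ, p.1 ∈ sphere (0 : ℂ) 1) ∧
  ∀ l ∈ sphere (0 : ℂ) 1, ∃ c : ℝ → ℂ,
    IsSCC c ∧ (∀ t, c t ≠ 0) ∧ WindingOne c ∧ Set.range c = {w : ℂ | (l, w) ∈ Γ}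

/-- `g` is continuous on the closed unit disk and holomorphic on the open unit disk,
hence defines a holomorphic disk `{(λ, g λ) : λ ∈ Δ}`. -/
def HolDisk (g : ℂ → ℂ) : Prop :=
  ContinuousOn g (closedBall (0 : ℂ) 1) ∧ DifferentiableOn ℂ g (ball (0 : ℂ) 1)

/-- The trace `{(λ, g λ) : λ ∈ S¹}` of the disk defined by `g` lies in `Γ`. -/
def DiskTraceIn (g : ℂ → ℂ) (Γ : Set (ℂ × ℂ)) : Prop :=
  ∀ l ∈ sphere (0 : ℂ) 1, (l, g l) ∈ Γ

/-- The Wirtinger derivative `∂f/∂w = ½(∂f/∂x − i ∂f/∂y)` of `f : ℂ → ℝ`, as a complex number. -/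
def wirt (f : ℂ → ℝ) (w : ℂ) : ℂ :=
  (((fderiv ℝ f w 1 : ℝ) : ℂ) - Complex.I * ((fderiv ℝ f w Complex.I : ℝ) : ℂ)) / 2

/-- The torus `Γ^t = {(λ, w) : λ ∈ S¹, F(λ,w) = t}` cut out by the defining function `F`. -/
def TorusOf (F : ℂ → ℂ → ℝ) (t : ℝ) : Set (ℂ × ℂ) :=
  {p : ℂ × ℂ | p.1 ∈ sphere (0 : ℂ) 1 ∧ F p.1 p.2 = t}

/-- `F : S¹ × ℂ → ℝ` is a smooth defining function of a smooth family of graphical tori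
`Γ^t = F⁻¹(t)`, `t > 0`: each slice level set is a smooth simple closed curve of winding
number `1` around `0`, the level sets foliate `ℂ ∖ {0}` for each fixed `λ ∈ S¹`,
`F(λ,w) = |w|²` near `w = 0`, and `∂F/∂w ≠ 0` for `w ≠ 0`. -/
def IsSmoothTorusFamily (F : ℂ → ℂ → ℝ) : Prop :=
  ContDiffOn ℝ (⊤ : ℕ∞) (fun p : ℂ × ℂ => F p.1 p.2) (sphere (0 : ℂ) 1 ×ˢ univ) ∧
  (∀ l ∈ sphere (0 : ℂ) 1, ContDiff ℝ (⊤ : ℕ∞) (F l)) ∧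
  (∃ ε : ℝ, 0 < ε ∧ ∀ l ∈ sphere (0 : ℂ) 1, ∀ w : ℂ,
      Complex.normSq w < ε → F l w = Complex.normSq w) ∧
  (∀ l ∈ sphere (0 : ℂ) 1, ∀ w : ℂ, w ≠ 0 → 0 < F l w) ∧
  (∀ l ∈ sphere (0 : ℂ) 1, ∀ w : ℂ, w ≠ 0 → wirt (F l) w ≠ 0) ∧
  (∀ l ∈ sphere (0 : ℂ) 1, ∀ t : ℝ, 0 < t → ∃ c : ℝ → ℂ,
      IsSCC c ∧ (∀ s, c s ≠ 0) ∧ WindingOne c ∧ Set.range c = {w : ℂ | F l w = t})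

section

open scoped ContDiff

/-- A locally bounded family of lower bounds is dominated by a nondecreasing smooth function
which is positive on `[0, ∞)` and comes with a smooth primitive `G` vanishing at `c`. -/
lemma exists_smooth_majorant {X : Type*} (S : Set X) (a b : X → ℝ) (c : ℝ)
    (hb : ∀ T, ∃ C, ∀ x ∈ S, a x ≤ T → b x ≤ C) :
    ∃ G p : ℝ → ℝ, ContDiff ℝ ∞ G ∧ ContDiff ℝ ∞ p ∧ (∀ t, HasDerivAt G (p t) t) ∧ G c = 0 ∧
      (∀ t, 0 ≤ deriv p t) ∧ (∀ t, 0 ≤ t → 0 < p t) ∧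
      ∀ x ∈ S, 0 ≤ a x → b x ≤ p (a x) := by
  have primitive : ∀ q : ℝ → ℝ, ContDiff ℝ ∞ q → ∀ c : ℝ, ∃ G : ℝ → ℝ, ContDiff ℝ ∞ G ∧
      (∀ t, HasDerivAt G (q t) t) ∧ G c = 0 := by
    intro q hq c
    have hd : ∀ t, HasDerivAt (fun u => ∫ x in c..u, q x) (q t) t := fun t =>
      (hq.continuous.integral_hasStrictDerivAt c t).hasDerivAt
    refine ⟨fun u => ∫ x in c..u, q x, ?_, hd, by simp⟩
    rw [contDiff_infty_iff_deriv]
    refine ⟨fun t => (hd t).differentiableAt, ?_⟩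
    rwa [show deriv (fun u => ∫ x in c..u, q x) = q from funext fun t => (hd t).deriv]
  obtain ⟨q, hq⟩ := exists_contMDiffMap_forall_mem_convex_of_local_const (n := ⊤)
    (modelWithCornersSelf ℝ ℝ) (F := ℝ)
    (t := fun y => {r | 1 ≤ r ∧ ∀ x ∈ S, a x = y → b x ≤ r})
    (fun y r hr r' hr' α β hα hβ hαβ => by
      simp only [smul_eq_mul, mem_ofPred_eq] at hr hr' ⊢
      refine ⟨by nlinarith [hr.1, hr'.1], fun x hx hxy => ?_⟩
      have h1 := mul_le_mul_of_nonneg_left (hr.2 x hx hxy) hα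
      have h2 := mul_le_mul_of_nonneg_left (hr'.2 x hx hxy) hβ
      have h3 : b x = α * b x + β * b x := by rw [← add_mul, hαβ, one_mul]
      linarith)
    (fun y => by
      obtain ⟨C, hC⟩ := hb (y + 1)
      refine ⟨max C 1, ?_⟩
      filter_upwards [Iio_mem_nhds (lt_add_one y)] with z hz
      exact ⟨le_max_right _ _, fun x hx hxz =>
        (hC x hx (hxz.le.trans (le_of_lt hz))).trans (le_max_left _ _)⟩)
  have hqs : ContDiff ℝ ∞ q := q.contMDiff.contDiff
  have hdq : ContDiff ℝ ∞ (deriv q) := (contDiff_infty_iff_deriv.1 hqs).2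
  obtain ⟨r, hrs, hrd, hr0⟩ := primitive (fun t => deriv q t ^ 2 + 1)
    ((hdq.pow 2).add contDiff_const) 0
  have hdiff : ∀ t, HasDerivAt (fun t => r t + q 0) (deriv q t ^ 2 + 1) t := fun t =>
    (hrd t).add_const _
  have hmono : Monotone fun t => r t + q 0 - q t := by
    refine monotone_of_deriv_nonneg
      (fun t => ((hdiff t).sub (hqs.differentiable (by simp) t).hasDerivAt).differentiableAt)
      fun t => ?_
    have : HasDerivAt (fun t => r t + q 0 - q t) _ t :=
      (hdiff t).sub (hqs.differentiable (by simp) t).hasDerivAt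
    rw [this.deriv]
    nlinarith [sq_nonneg (deriv q t - 1), sq_nonneg (deriv q t)]
  have hle : ∀ t, 0 ≤ t → q t ≤ r t + q 0 := fun t ht => by
    have := hmono ht
    simp only [hr0] at this
    linarith
  obtain ⟨G, hGs, hGd, hG0⟩ := primitive (fun t => r t + q 0) (hrs.add contDiff_const) c
  refine ⟨G, fun t => r t + q 0, hGs, hrs.add contDiff_const, hGd, hG0, fun t => ?_,
    fun t ht => ?_, fun x hx hax => ?_⟩
  · rw [(hdiff t).deriv]; positivity
  · linarith [hle t ht, (hq t).1]
  · exact ((hq (a x)).2 x hx rfl).trans (hle _ hax)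

/-- The exterior of an open disk in the plane is connected. -/
lemma isPreconnected_setOf_le_norm (R : ℝ) :
    IsPreconnected {w : ℂ | R ≤ ‖w‖} := by
  have h : {w : ℂ | R ≤ ‖w‖} =
      (fun p : ℝ × ℝ => (p.1 : ℂ) * Complex.exp (p.2 * Complex.I)) '' (Ici R ×ˢ univ) := by
    ext w
    simp only [mem_ofPred_eq, mem_image, mem_prod, mem_Ici, mem_univ, and_true, Prod.exists]
    constructor
    · intro hw
      exact ⟨‖w‖, arg w, hw, Complex.norm_mul_exp_arg_mul_I w⟩
    · rintro ⟨r, θ, hr, rfl⟩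
      simpa [Complex.norm_exp_ofReal_mul_I] using hr.trans (le_abs_self r)
  rw [h]
  exact ((convex_Ici R).isPreconnected.prod isPreconnected_univ).image _
    (by fun_prop)

lemma lt_of_forall_ne_of_isPreconnected {f : ℂ → ℝ} (hf : Continuous f) {s : Set ℂ}
    (hs : IsPreconnected s) {T : ℝ} (hne : ∀ w ∈ s, f w ≠ T) {x y : ℂ} (hx : x ∈ s) (hy : y ∈ s)
    (hT : T < f x) : T < f y := by
  by_contra! h
  obtain ⟨z, hz, hzT⟩ := hs.intermediate_value hy hx hf.continuousOn ⟨h, hT.le⟩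
  exact hne z hz hzT

/-- A continuous function on the plane that attains every positive value and has a compact
level set `{f = T}` exceeds `T` near infinity. -/
lemma exists_forall_le_norm_lt {f : ℂ → ℝ} (hf : Continuous f) {T : ℝ} (hT : 0 < T)
    (hc : IsCompact {w | f w = T}) (hsurj : ∀ t, 0 < t → ∃ w, f w = t) :
    ∃ R, 0 < R ∧ ∀ w, R ≤ ‖w‖ → T < f w := by
  obtain ⟨R₀, hR₀⟩ := hc.isBounded.exists_norm_le
  set R := max R₀ 0 + 1
  have hR : 0 < R := by positivity
  have hR₀R : R₀ < R := (le_max_left _ _).trans_lt (lt_add_one _)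
  obtain ⟨C, hC⟩ := (isCompact_closedBall (0 : ℂ) R).bddAbove_image hf.continuousOn
  obtain ⟨x, hx⟩ := hsurj (max C T + 1) (by positivity)
  have hxR : R ≤ ‖x‖ := by
    by_contra! h
    have := hC (mem_image_of_mem f (mem_closedBall_zero_iff.2 h.le))
    linarith [le_max_left C T]
  refine ⟨R, hR, fun w hw => lt_of_forall_ne_of_isPreconnected hf
    (isPreconnected_setOf_le_norm R) (fun z hz hzT => ?_) hxR hw ?_⟩
  · exact absurd (hR₀ z hzT) (not_le.2 (hR₀R.trans_le hz))
  · linarith [le_max_right C T]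

/-- Uniform properness of a continuous family of functions on the plane with compact connected
level sets. -/
lemma exists_uniform_radius {F : ℂ → ℂ → ℝ} {S : Set ℂ} (hS : IsCompact S)
    (hF : ContinuousOn (fun p : ℂ × ℂ => F p.1 p.2) (S ×ˢ univ))
    (h0 : ∀ l ∈ S, F l 0 = 0)
    (hlev : ∀ l ∈ S, ∀ t : ℝ, 0 < t → {w | F l w = t}.Nonempty ∧ IsCompact {w | F l w = t} ∧
      IsPreconnected {w | F l w = t})
    {T : ℝ} (hT : 0 < T) :
    ∃ R, ∀ l ∈ S, ∀ w, F l w ≤ T → ‖w‖ ≤ R := by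
  have hslice : ∀ l ∈ S, Continuous (F l) := fun l hl => by
    rw [← continuousOn_univ]
    exact hF.comp (f := fun w => (l, w)) (by fun_prop) fun w _ => ⟨hl, mem_univ w⟩
  refine hS.induction_on (p := fun s => ∃ R, ∀ l ∈ s, l ∈ S → ∀ w, F l w ≤ T → ‖w‖ ≤ R) ?_ ?_ ?_ ?_
    |>.imp fun R h l hl => h l hl hl
  · exact ⟨0, by simp⟩
  · rintro s t hst ⟨R, hR⟩
    exact ⟨R, fun l hl => hR l (hst hl)⟩
  · rintro s t ⟨R, hR⟩ ⟨R', hR'⟩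
    refine ⟨max R R', fun l hl hlS w hw => ?_⟩
    rcases hl with hl | hl
    · exact (hR l hl hlS w hw).trans (le_max_left _ _)
    · exact (hR' l hl hlS w hw).trans (le_max_right _ _)
  · intro l₀ hl₀
    obtain ⟨R, hR, hRT⟩ := exists_forall_le_norm_lt (hslice l₀ hl₀) hT (hlev l₀ hl₀ T hT).2.1
      fun t ht => (hlev l₀ hl₀ t ht).1
    have hev : ∀ᶠ l in nhds l₀, ∀ w ∈ sphere (0 : ℂ) R, l ∈ S → T < F l w := by
      refine (isCompact_sphere (0 : ℂ) R).eventually_forall_of_forall_eventually fun w hw => ?_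
      have := (hF (l₀, w) ⟨hl₀, mem_univ w⟩).eventually
        (lt_mem_nhds (hRT w (mem_sphere_zero_iff_norm.1 hw).ge))
      filter_upwards [eventually_nhdsWithin_iff.1 this] with p hp hpS
      exact hp ⟨hpS, mem_univ _⟩
    refine ⟨_, mem_nhdsWithin_of_mem_nhds hev, R, fun l hl hlS w hw => ?_⟩
    have hRmem : ((R : ℂ)) ∈ sphere (0 : ℂ) R := by simp [abs_of_pos hR]
    obtain ⟨z, hz, hzT⟩ : ∃ z ∈ ball (0 : ℂ) R, F l z = T := by
      obtain ⟨z, hz, hzT⟩ := (convex_closedBall (0 : ℂ) R).isPreconnected.intermediate_value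
        (mem_closedBall_self hR.le) (sphere_subset_closedBall hRmem) (hslice l hlS).continuousOn
        ⟨(h0 l hlS).le.trans hT.le, (hl _ hRmem hlS).le⟩
      refine ⟨z, mem_ball.2 (lt_of_le_of_ne hz fun h => ?_), hzT⟩
      exact (hl z h hlS).ne' hzT
    have hin : ∀ y, F l y = T → ‖y‖ < R := by
      intro y hy
      by_contra! h
      obtain ⟨x, hx, hxR⟩ := (hlev l hlS T hT).2.2.intermediate_value hzT hy
        continuous_norm.continuousOn ⟨(mem_ball_zero_iff.1 hz).le, h⟩
      exact (hl x (mem_sphere_zero_iff_norm.2 hxR) hlS).ne' hx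
    by_contra! h
    refine hw.not_gt (lt_of_forall_ne_of_isPreconnected (hslice l hlS)
      (isPreconnected_setOf_le_norm R) (fun y hy hyT => ?_)
      (mem_sphere_zero_iff_norm.1 hRmem).ge h.le (hl _ hRmem hlS))
    exact (hin y hyT).not_ge hy

lemma contDiff_slice {f : ℂ → ℂ → ℝ} {s : Set ℂ}
    (hf : ContDiffOn ℝ ∞ (fun p : ℂ × ℂ => f p.1 p.2) (s ×ˢ univ)) {l : ℂ} (hl : l ∈ s) :
    ContDiff ℝ ∞ (f l) := by
  rw [← contDiffOn_univ]
  exact hf.comp (f := fun w => (l, w)) (by fun_prop) fun w _ => ⟨hl, mem_univ w⟩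

/-- Vertical directional derivatives of a function smooth up to the boundary of `Δ̄ × ℂ` are
again smooth up to the boundary. -/
lemma contDiffOn_fderiv_slice {f : ℂ → ℂ → ℝ}
    (hf : ContDiffOn ℝ ∞ (fun p : ℂ × ℂ => f p.1 p.2) (closedBall (0 : ℂ) 1 ×ˢ univ)) (v : ℂ) :
    ContDiffOn ℝ ∞ (fun p : ℂ × ℂ => fderiv ℝ (f p.1) p.2 v)
      (closedBall (0 : ℂ) 1 ×ˢ univ) := by
  have hs : UniqueDiffOn ℝ (closedBall (0 : ℂ) 1 ×ˢ (univ : Set ℂ)) :=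
    (uniqueDiffOn_convex (convex_closedBall _ _)
      ⟨0, by simp [interior_closedBall (0 : ℂ) one_ne_zero]⟩).prod uniqueDiffOn_univ
  refine ((hf.fderivWithin hs (m := ∞) le_rfl).clm_apply
    (contDiffOn_const (c := ((0 : ℂ), v)))).congr fun p hp => ?_
  have h1 := (hf.differentiableOn (by simp) p hp).hasFDerivWithinAt
  have h2 : HasFDerivAt (fun w : ℂ => (p.1, w)) (ContinuousLinearMap.inr ℝ ℂ ℂ) p.2 :=
    hasFDerivAt_prodMk_right p.1 p.2
  have h3 := HasFDerivWithinAt.comp (s := univ) (f := fun w : ℂ => (p.1, w)) p.2 h1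
    h2.hasFDerivWithinAt fun w _ => ⟨hp.1, mem_univ w⟩
  rw [hasFDerivWithinAt_univ] at h3
  rw [show f p.1 = (fun p : ℂ × ℂ => f p.1 p.2) ∘ fun w => (p.1, w) from rfl, h3.fderiv]
  simp

lemma contDiff_fderiv_apply {f : ℂ → ℝ} (hf : ContDiff ℝ ∞ f) (v : ℂ) :
    ContDiff ℝ ∞ fun z => fderiv ℝ f z v :=
  (hf.fderiv_right (m := ∞) le_rfl).clm_apply contDiff_const

lemma lap_eq {f : ℂ → ℝ} (hf : ContDiff ℝ ∞ f) (w : ℂ) :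
    lap f w = fderiv ℝ (fun z => fderiv ℝ f z 1) w 1 +
      fderiv ℝ (fun z => fderiv ℝ f z Complex.I) w Complex.I := by
  have hd : DifferentiableAt ℝ (fderiv ℝ f) w :=
    (hf.fderiv_right (m := ∞) le_rfl).differentiable (by simp) w
  have key : ∀ v : ℂ, fderiv ℝ (fun z => fderiv ℝ f z v) w v = fderiv ℝ (fderiv ℝ f) w v v :=
    fun v => by rw [fderiv_clm_apply hd (differentiableAt_const v)]; simp
  rw [lap, iteratedFDeriv_two_apply, iteratedFDeriv_two_apply, key, key]
  simp

lemma continuousOn_lap {f : ℂ → ℂ → ℝ}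
    (hf : ContDiffOn ℝ ∞ (fun p : ℂ × ℂ => f p.1 p.2) (closedBall (0 : ℂ) 1 ×ˢ univ)) :
    ContinuousOn (fun p : ℂ × ℂ => lap (f p.1) p.2) (closedBall (0 : ℂ) 1 ×ˢ univ) := by
  have key := fun v => (contDiffOn_fderiv_slice (f := fun l w => fderiv ℝ (f l) w v)
    (contDiffOn_fderiv_slice hf v) v).continuousOn
  exact ((key 1).add (key Complex.I)).congr fun p hp => lap_eq (contDiff_slice hf hp.1) p.2

lemma lap_add_const_mul {f g : ℂ → ℝ} (hf : ContDiff ℝ ∞ f) (hg : ContDiff ℝ ∞ g) (c : ℝ)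
    (w : ℂ) : lap (fun z => f z + c * g z) w = lap f w + c * lap g w := by
  have key : ∀ {a b : ℂ → ℝ}, ContDiff ℝ ∞ a → ContDiff ℝ ∞ b → ∀ z v : ℂ,
      fderiv ℝ (fun z => a z + c * b z) z v = fderiv ℝ a z v + c * fderiv ℝ b z v := by
    intro a b ha hb z v
    have := (ha.differentiable (by simp) z).hasFDerivAt.add
      ((hb.differentiable (by simp) z).hasFDerivAt.const_mul c)
    rw [show (fun z => a z + c * b z) = a + fun z => c * b z from rfl, this.fderiv]
    simp
  rw [lap_eq hf, lap_eq hg, lap_eq (hf.add (contDiff_const.mul hg))]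
  simp only [key hf hg]
  rw [key (contDiff_fderiv_apply hf _) (contDiff_fderiv_apply hg _),
    key (contDiff_fderiv_apply hf _) (contDiff_fderiv_apply hg _)]
  ring

lemma lap_comp {f : ℂ → ℝ} {g g' g'' : ℝ → ℝ} (hf : ContDiff ℝ ∞ f) (hg : ContDiff ℝ ∞ g)
    (hg' : ∀ t, HasDerivAt g (g' t) t) (hg'' : ∀ t, HasDerivAt g' (g'' t) t) (w : ℂ) :
    lap (fun z => g (f z)) w = g' (f w) * lap f w +
      g'' (f w) * (fderiv ℝ f w 1 ^ 2 + fderiv ℝ f w Complex.I ^ 2) := by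
  have chain : ∀ {k k' : ℝ → ℝ}, (∀ t, HasDerivAt k (k' t) t) → ∀ z,
      HasFDerivAt (fun z => k (f z)) (k' (f z) • fderiv ℝ f z) z := fun hk z =>
    (hk (f z)).comp_hasFDerivAt z (hf.differentiable (by simp) z).hasFDerivAt
  have hfst : ∀ v, (fun z => fderiv ℝ (fun z => g (f z)) z v) =
      fun z => g' (f z) * fderiv ℝ f z v := fun v => funext fun z => by
    rw [(chain hg' z).fderiv]; simp
  have hsnd : ∀ v, fderiv ℝ (fun z => g' (f z) * fderiv ℝ f z v) w v =
      g' (f w) * fderiv ℝ (fun z => fderiv ℝ f z v) w v + g'' (f w) * fderiv ℝ f w v ^ 2 := by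
    intro v
    have := (chain hg'' w).mul
      ((contDiff_fderiv_apply hf v).differentiable (by simp) w).hasFDerivAt
    rw [show (fun z => g' (f z) * fderiv ℝ f z v) =
      (fun z => g' (f z)) * fun z => fderiv ℝ f z v from rfl, this.fderiv]
    simp
    ring
  rw [lap_eq hf, lap_eq (f := fun z => g (f z)) (hg.comp hf), hfst, hfst, hsnd, hsnd]
  ring

lemma contDiff_normSq : ContDiff ℝ ∞ Complex.normSq := by
  have : (Complex.normSq : ℂ → ℝ) = fun z => ‖z‖ ^ 2 := funext Complex.normSq_eq_norm_sq
  rw [this]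
  exact contDiff_id.norm_sq ℝ

lemma fderiv_normSq_apply (w v : ℂ) :
    fderiv ℝ Complex.normSq w v = 2 * (w.re * v.re + w.im * v.im) := by
  have h : HasFDerivAt (fun z : ℂ => Complex.reCLM z * Complex.reCLM z +
      Complex.imCLM z * Complex.imCLM z) _ w :=
    (Complex.reCLM.hasFDerivAt.mul Complex.reCLM.hasFDerivAt).add
      (Complex.imCLM.hasFDerivAt.mul Complex.imCLM.hasFDerivAt)
  have h' : (Complex.normSq : ℂ → ℝ) = fun z : ℂ => Complex.reCLM z * Complex.reCLM z +
      Complex.imCLM z * Complex.imCLM z := funext fun z => Complex.normSq_apply z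
  rw [h', h.fderiv]
  simp
  ring

lemma lap_normSq (w : ℂ) : lap Complex.normSq w = 4 := by
  have hre : fderiv ℝ (fun z : ℂ => 2 * z.re) w 1 = 2 := by
    have : HasFDerivAt (fun z : ℂ => 2 * z.re) _ w := Complex.reCLM.hasFDerivAt.const_mul 2
    rw [this.fderiv]; simp
  have him : fderiv ℝ (fun z : ℂ => 2 * z.im) w Complex.I = 2 := by
    have : HasFDerivAt (fun z : ℂ => 2 * z.im) _ w := Complex.imCLM.hasFDerivAt.const_mul 2
    rw [this.fderiv]; simp
  rw [lap_eq contDiff_normSq]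
  simp only [fderiv_normSq_apply]
  simp [hre, him]
  norm_num

lemma sq_add_sq_pos_of_wirt_ne_zero {f : ℂ → ℝ} {w : ℂ} (h : wirt f w ≠ 0) :
    0 < fderiv ℝ f w 1 ^ 2 + fderiv ℝ f w Complex.I ^ 2 := by
  by_contra! h'
  refine h ?_
  have h1 : fderiv ℝ f w 1 = 0 := by nlinarith [sq_nonneg (fderiv ℝ f w Complex.I)]
  have h2 : fderiv ℝ f w Complex.I = 0 := by nlinarith [sq_nonneg (fderiv ℝ f w 1)]
  simp [wirt, h1, h2]

lemma isCompact_and_isPreconnected_range_of_isSCC {c : ℝ → ℂ} (hc : IsSCC c) :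
    IsCompact (range c) ∧ IsPreconnected (range c) := by
  refine ⟨?_, isPreconnected_range hc.1.continuous⟩
  have hper : Function.Periodic c (2 * Real.pi) := hc.2.1
  rw [← hper.image_Icc Real.two_pi_pos 0]
  exact isCompact_Icc.image hc.1.continuous

/-- If `L` is continuous on `Δ̄ × ℂ` and positive over the boundary circle, then, locally
uniformly in `w`, the negative part of `L` is at most a multiple of `1 - ‖l‖ ^ 2`. -/
lemma exists_forall_neg_div_le {L : ℂ × ℂ → ℝ}
    (hL : ContinuousOn L (closedBall (0 : ℂ) 1 ×ˢ univ))
    (hpos : ∀ l ∈ sphere (0 : ℂ) 1, ∀ w, 0 < L (l, w)) (T : ℝ) :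
    ∃ C, ∀ p ∈ ball (0 : ℂ) 1 ×ˢ (univ : Set ℂ), Complex.normSq p.2 ≤ T →
      -L p / (1 - ‖p.1‖ ^ 2) ≤ C := by
  set K : Set (ℂ × ℂ) := closedBall (0 : ℂ) 1 ×ˢ closedBall (0 : ℂ) (Real.sqrt T)
  have hKs : K ⊆ closedBall (0 : ℂ) 1 ×ˢ univ := prod_mono_right (subset_univ _)
  have hK : IsCompact (K ∩ L ⁻¹' Iic 0) :=
    ((isCompact_closedBall _ _).prod (isCompact_closedBall _ _)).of_isClosed_subset
      ((hL.mono hKs).preimage_isClosed_of_isClosed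
        (isClosed_closedBall.prod isClosed_closedBall) isClosed_Iic) inter_subset_left
  have hne : ∀ p ∈ K ∩ L ⁻¹' Iic 0, 1 - ‖p.1‖ ^ 2 ≠ 0 := by
    rintro p ⟨hp, hpL⟩ h
    have h1 : ‖p.1‖ = 1 := by
      have := norm_nonneg p.1
      nlinarith
    exact (hpos p.1 (mem_sphere_zero_iff_norm.2 h1) p.2).not_ge hpL
  obtain ⟨C, hC⟩ := hK.bddAbove_image (f := fun p => -L p / (1 - ‖p.1‖ ^ 2))
    ((hL.mono (inter_subset_left.trans hKs)).neg.div (by fun_prop) hne)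
  refine ⟨max C 0, fun p hp hpT => ?_⟩
  have hp1 : ‖p.1‖ < 1 := mem_ball_zero_iff.1 hp.1
  by_cases h : L p ≤ 0
  · refine (hC (mem_image_of_mem _ ⟨⟨ball_subset_closedBall hp.1, ?_⟩, h⟩)).trans (le_max_left _ _)
    rw [mem_closedBall_zero_iff]
    rw [Complex.normSq_eq_norm_sq] at hpT
    exact Real.le_sqrt_of_sq_le hpT
  · refine le_trans (div_nonpos_of_nonpos_of_nonneg (by linarith) ?_) (le_max_right _ _)
    nlinarith [norm_nonneg p.1]

lemma exists_forall_one_sub_lap_div_le {F : ℂ → ℂ → ℝ} (hF : IsSmoothTorusFamily F)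
    (hFs : ContDiffOn ℝ ∞ (fun p : ℂ × ℂ => F p.1 p.2) (closedBall (0 : ℂ) 1 ×ˢ univ))
    (h0 : ∀ l ∈ sphere (0 : ℂ) 1, F l 0 = 0) {ε : ℝ} (hε : 0 < ε) (T : ℝ) :
    ∃ C, ∀ p ∈ sphere (0 : ℂ) 1 ×ˢ {w : ℂ | ε ≤ ‖w‖}, F p.1 p.2 ≤ T →
      1 - lap (F p.1) p.2 /
        (fderiv ℝ (F p.1) p.2 1 ^ 2 + fderiv ℝ (F p.1) p.2 Complex.I ^ 2) ≤ C := by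
  obtain ⟨hFc, -, -, -, hw, hlev⟩ := hF
  obtain ⟨R, hR⟩ := exists_uniform_radius (isCompact_sphere (0 : ℂ) 1) hFc.continuousOn h0
    (fun l hl t ht => by
      obtain ⟨c, hc, -, -, hr⟩ := hlev l hl t ht
      rw [← hr]
      exact ⟨range_nonempty c, isCompact_and_isPreconnected_range_of_isSCC hc⟩)
    (T := max T 1) (by positivity)
  have hK : IsCompact (sphere (0 : ℂ) 1 ×ˢ (closedBall (0 : ℂ) R ∩ {w : ℂ | ε ≤ ‖w‖})) :=
    (isCompact_sphere _ _).prod ((isCompact_closedBall _ _).inter_right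
      (isClosed_le continuous_const continuous_norm))
  have hsub : sphere (0 : ℂ) 1 ×ˢ (closedBall (0 : ℂ) R ∩ {w : ℂ | ε ≤ ‖w‖}) ⊆
      closedBall (0 : ℂ) 1 ×ˢ univ := prod_mono sphere_subset_closedBall (subset_univ _)
  have hD := fun v => (contDiffOn_fderiv_slice hFs v).continuousOn.mono hsub
  obtain ⟨C, hC⟩ := hK.bddAbove_image (f := fun p => 1 - lap (F p.1) p.2 /
      (fderiv ℝ (F p.1) p.2 1 ^ 2 + fderiv ℝ (F p.1) p.2 Complex.I ^ 2))
    (continuousOn_const.sub (((continuousOn_lap hFs).mono hsub).div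
      (((hD 1).pow 2).add ((hD Complex.I).pow 2)) fun p hp =>
        (sq_add_sq_pos_of_wirt_ne_zero (hw p.1 hp.1 p.2
          (norm_pos_iff.1 (hε.trans_le hp.2.2)))).ne'))
  exact ⟨C, fun p hp hpT => hC (mem_image_of_mem _ ⟨hp.1,
    mem_closedBall_zero_iff.2 (hR p.1 hp.1 p.2 (hpT.trans (le_max_left _ _))), hp.2⟩)⟩

lemma lap_eq_four_of_forall_norm_le {f : ℂ → ℝ} {ε : ℝ}
    (hf : ∀ w : ℂ, ‖w‖ ≤ ε → f w = Complex.normSq w) {w : ℂ} (hw : ‖w‖ < ε) : lap f w = 4 := by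
  have h : f =ᶠ[nhds w] Complex.normSq := by
    filter_upwards [isOpen_ball.mem_nhds (mem_ball_zero_iff.2 hw)] with z hz
    exact hf z (mem_ball_zero_iff.1 hz).le
  rw [← lap_normSq w, lap, lap, h.iteratedFDeriv ℝ 2 |>.eq_of_nhds]

/-- The defining function of a torus family can be reparametrized to `exp (G ∘ F)` with positive
fibrewise Laplacian over the circle. -/
lemma exists_reparametrization_lap_pos {F : ℂ → ℂ → ℝ} (hF : IsSmoothTorusFamily F)
    (hFs : ContDiffOn ℝ ∞ (fun p : ℂ × ℂ => F p.1 p.2) (closedBall (0 : ℂ) 1 ×ˢ univ))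
    {ε : ℝ} (hε : 0 < ε)
    (hFnear : ∀ l ∈ closedBall (0 : ℂ) 1, ∀ w : ℂ, ‖w‖ ≤ ε → F l w = Complex.normSq w) :
    ∃ G : ℝ → ℝ, ContDiff ℝ ∞ G ∧ StrictMonoOn G (Ici 0) ∧ G 1 = 0 ∧
      ∀ l ∈ sphere (0 : ℂ) 1, ∀ w : ℂ, 0 < lap (fun z => Real.exp (G (F l z))) w := by
  have h0 : ∀ l ∈ sphere (0 : ℂ) 1, F l 0 = 0 := fun l hl => by
    simpa using hFnear l (sphere_subset_closedBall hl) 0 (by simpa using hε.le)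
  have hnonneg : ∀ l ∈ sphere (0 : ℂ) 1, ∀ w, 0 ≤ F l w := fun l hl w => by
    rcases eq_or_ne w 0 with rfl | hw
    · exact (h0 l hl).ge
    · exact (hF.2.2.2.1 l hl w hw).le
  obtain ⟨G, p, hGs, hps, hGp, hG1, hp', hp, hpb⟩ := exists_smooth_majorant
    (sphere (0 : ℂ) 1 ×ˢ {w : ℂ | ε ≤ ‖w‖}) (fun p => F p.1 p.2) _ 1
    (exists_forall_one_sub_lap_div_le hF hFs h0 hε)
  refine ⟨G, hGs, ?_, hG1, fun l hl w => ?_⟩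
  · refine strictMonoOn_of_deriv_pos (convex_Ici 0) hGs.continuous.continuousOn fun t ht => ?_
    rw [interior_Ici] at ht
    rw [(hGp t).deriv]
    exact hp t (le_of_lt ht)
  · have hexp : ∀ t, HasDerivAt (fun t => Real.exp (G t)) (Real.exp (G t) * p t) t :=
      fun t => (hGp t).exp
    have hlc : l ∈ closedBall (0 : ℂ) 1 := sphere_subset_closedBall hl
    rw [lap_comp (g := fun t => Real.exp (G t)) (contDiff_slice hFs hlc) hGs.exp hexp
      fun t => (hexp t).mul (hps.differentiable (by simp) t).hasDerivAt]
    set A := lap (F l) w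
    set B := fderiv ℝ (F l) w 1 ^ 2 + fderiv ℝ (F l) w Complex.I ^ 2 with hB
    set t := F l w
    have hB0 : 0 ≤ B := by positivity
    have hpt : 0 < p t := hp t (hnonneg l hl w)
    have key : 0 < A + p t * B := by
      rcases lt_or_ge ‖w‖ ε with h | h
      · have : A = 4 := lap_eq_four_of_forall_norm_le (hFnear l hlc) h
        rw [this]
        positivity
      · have hBpos : 0 < B := sq_add_sq_pos_of_wirt_ne_zero
          (hF.2.2.2.2.1 l hl w (norm_pos_iff.1 (hε.trans_le h)))
        have h1 : 1 - A / B ≤ p t := hpb (l, w) ⟨hl, h⟩ (hnonneg l hl w)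
        have h2 := mul_le_mul_of_nonneg_right h1 hB0
        rw [sub_mul, div_mul_cancel₀ _ hBpos.ne'] at h2
        linarith
    have : Real.exp (G t) * p t * A +
        (Real.exp (G t) * p t * p t + Real.exp (G t) * deriv p t) * B =
        Real.exp (G t) * (p t * (A + p t * B) + deriv p t * B) := by ring
    rw [this]
    have := hp' t
    positivity

/-- A smooth function on `Δ̄ × ℂ` that is fibrewise strictly subharmonic over the circle becomes
so over the whole closed disk after adding `(1 - ‖l‖ ^ 2) * h (‖w‖ ^ 2)` for a suitable `h`. -/
lemma exists_lap_add_pos {f : ℂ → ℂ → ℝ}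
    (hf : ContDiffOn ℝ ∞ (fun p : ℂ × ℂ => f p.1 p.2) (closedBall (0 : ℂ) 1 ×ˢ univ))
    (hpos : ∀ l ∈ sphere (0 : ℂ) 1, ∀ w, 0 < lap (f l) w) :
    ∃ h : ℝ → ℝ, ContDiff ℝ ∞ h ∧ (∀ t, 0 ≤ t → 0 ≤ h t) ∧
      ∀ l ∈ closedBall (0 : ℂ) 1, ∀ w,
        0 < lap (fun z => f l z + (1 - ‖l‖ ^ 2) * h (Complex.normSq z)) w := by
  obtain ⟨h, u, hhs, hus, hhu, hh0, hu', hu, hub⟩ := exists_smooth_majorant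
    (ball (0 : ℂ) 1 ×ˢ (univ : Set ℂ)) (fun p => Complex.normSq p.2) _ 0
    (exists_forall_neg_div_le (continuousOn_lap hf) hpos)
  refine ⟨h, hhs, fun t ht => ?_, fun l hl w => ?_⟩
  · have hmono : MonotoneOn h (Ici 0) := by
      refine monotoneOn_of_deriv_nonneg (convex_Ici 0) hhs.continuous.continuousOn
        (hhs.differentiable (by simp)).differentiableOn fun t ht => ?_
      rw [interior_Ici] at ht
      rw [(hhu t).deriv]
      exact (hu t (le_of_lt ht)).le
    simpa [hh0] using hmono self_mem_Ici ht ht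
  · rw [lap_add_const_mul (g := fun z => h (Complex.normSq z)) (contDiff_slice hf hl)
      (hhs.comp contDiff_normSq), lap_comp contDiff_normSq hhs hhu
        fun t => (hus.differentiable (by simp) t).hasDerivAt, lap_normSq]
    set t := Complex.normSq w
    have ht : 0 ≤ t := Complex.normSq_nonneg w
    have hB : 0 ≤ deriv u t *
        (fderiv ℝ Complex.normSq w 1 ^ 2 + fderiv ℝ Complex.normSq w Complex.I ^ 2) :=
      mul_nonneg (hu' t) (by positivity)
    have hut := hu t ht
    rcases (mem_closedBall_zero_iff.1 hl).eq_or_lt with h1 | h1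
    · simpa [h1] using hpos l (mem_sphere_zero_iff_norm.2 h1) w
    · have hd : 0 < 1 - ‖l‖ ^ 2 := by nlinarith [norm_nonneg l]
      have h2 : -lap (f l) w / (1 - ‖l‖ ^ 2) ≤ u t :=
        hub (l, w) ⟨mem_ball_zero_iff.2 h1, mem_univ w⟩ ht
      rw [div_le_iff₀ hd] at h2
      nlinarith [mul_nonneg hd.le hB, mul_pos hd hut]

end

/-- **Existence of a fiberwise subharmonic defining function `φ`.** Given a smooth family
of graphical tori with defining function `F`, extended smoothly to `Δ̄ × ℂ` with
`F(λ,w) = |w|²` for `‖w‖ ≤ ε` and `∂F/∂w ≠ 0` for `w ≠ 0`, there is a smooth nonnegative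
`φ : Δ̄ × ℂ → ℝ` with `Δ_w φ > 0`, whose restriction to `S¹ × ℂ` defines the foliation by
the tori `Γ^t` (it is a strictly increasing reparametrization `ρ ∘ F` of `F` there), and
with `φ_λ⁻¹(1) = C_λ = C¹_λ` for `|λ| = 1`. -/
theorem exists_subharmonic_defining_function (F : ℂ → ℂ → ℝ)
    (hF : IsSmoothTorusFamily F)
    (hFs : ContDiffOn ℝ (⊤ : ℕ∞) (fun p : ℂ × ℂ => F p.1 p.2)
      (closedBall (0 : ℂ) 1 ×ˢ univ))
    (ε : ℝ) (hε : 0 < ε)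
    (hFnear : ∀ l ∈ closedBall (0 : ℂ) 1, ∀ w : ℂ, ‖w‖ ≤ ε → F l w = Complex.normSq w)
    (hFw : ∀ l ∈ closedBall (0 : ℂ) 1, ∀ w : ℂ, w ≠ 0 → wirt (F l) w ≠ 0) :
    ∃ φ : ℂ → ℂ → ℝ,
      ContDiffOn ℝ (⊤ : ℕ∞) (fun p : ℂ × ℂ => φ p.1 p.2)
        (closedBall (0 : ℂ) 1 ×ˢ univ) ∧
      (∀ l ∈ closedBall (0 : ℂ) 1, ∀ w : ℂ, 0 ≤ φ l w) ∧
      (∀ l ∈ closedBall (0 : ℂ) 1, ∀ w : ℂ, 0 < lap (φ l) w) ∧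
      (∃ ρ : ℝ → ℝ, StrictMonoOn ρ (Ici 0) ∧ ρ 1 = 1 ∧
        ∀ l ∈ sphere (0 : ℂ) 1, ∀ w : ℂ, φ l w = ρ (F l w)) ∧
      (∀ l ∈ sphere (0 : ℂ) 1, ∀ w : ℂ, (φ l w = 1 ↔ F l w = 1)) := by
  obtain ⟨G, hGs, hGmono, hG1, hGlap⟩ := exists_reparametrization_lap_pos hF hFs hε hFnear
  have hs : ContDiffOn ℝ (⊤ : ℕ∞) (fun p : ℂ × ℂ => Real.exp (G (F p.1 p.2)))
      (closedBall (0 : ℂ) 1 ×ˢ univ) := (hGs.comp_contDiffOn hFs).exp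
  obtain ⟨h, hhs, hh, hlap⟩ := exists_lap_add_pos (f := fun l w => Real.exp (G (F l w))) hs hGlap
  have hnonneg : ∀ l ∈ sphere (0 : ℂ) 1, ∀ w, 0 ≤ F l w := fun l hl w => by
    rcases eq_or_ne w 0 with rfl | hw
    · exact (hFnear l (sphere_subset_closedBall hl) 0 (by simpa using hε.le)).ge.trans' (by simp)
    · exact (hF.2.2.2.1 l hl w hw).le
  have hbdry : ∀ l ∈ sphere (0 : ℂ) 1, ∀ w : ℂ,
      Real.exp (G (F l w)) + (1 - ‖l‖ ^ 2) * h (Complex.normSq w) = Real.exp (G (F l w)) :=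
    fun l hl w => by simp [mem_sphere_zero_iff_norm.1 hl]
  refine ⟨fun l w => Real.exp (G (F l w)) + (1 - ‖l‖ ^ 2) * h (Complex.normSq w), ?_, ?_, hlap,
    ⟨fun t => Real.exp (G t), Real.exp_strictMono.comp_strictMonoOn hGmono, by simp [hG1],
      hbdry⟩, fun l hl w => ?_⟩
  · refine hs.add (ContDiff.contDiffOn ?_)
    exact (contDiff_const.sub (contDiff_fst.norm_sq ℝ)).mul
      (hhs.comp (contDiff_normSq.comp contDiff_snd))
  · intro l hl w
    have hl1 := mem_closedBall_zero_iff.1 hl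
    have h1 : 0 ≤ 1 - ‖l‖ ^ 2 := by nlinarith [norm_nonneg l]
    have h2 := hh _ (Complex.normSq_nonneg w)
    positivity
  · beta_reduce
    rw [hbdry l hl w, Real.exp_eq_one_iff, ← hG1]
    exact hGmono.eq_iff_eq (hnonneg l hl w) (mem_Ici.2 zero_le_one)
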